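/- arXiv:math/0608131 — 7 statements merged into one kernel-verified Lean document; each statement's English description precedes it below -/
import Mathlib

section
/- Let n be a positive integer. For an integer k with 0 ≤ k ≤ n−1, the number of subsets A ⊆ {0,...,n−1} with k ∉ A+A, divided by 2^n, equals (3/4)^{(k+1)/2} if k is odd and (1/2)·(3/4)^{k/2} if k is even. For an integer k with n−1 ≤ k ≤ 2n−2, the number of subsets A ⊆ {0,...,n−1} with k ∉ A+A, divided by 2^n, equals (3/4)^{n−(k+1)/2} if k is odd and (1/2)·(3/4)^{n−1−k/2} if k is even. -/
open Finset Pointwise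

/-- The number of subsets `A` of `S` such that `k` is not a sum of two elements of `A`. -/
def missingSumCount (k : ℤ) (S : Finset ℤ) : ℕ :=
  (S.powerset.filter (fun A : Finset ℤ => k ∉ A + A)).card

lemma notMem_add_self_iff {k : ℤ} {A : Finset ℤ} : k ∉ A + A ↔ ∀ a ∈ A, k - a ∉ A := by
  rw [Finset.mem_add]
  constructor
  · intro h a ha hb
    exact h ⟨a, ha, k - a, hb, by ring⟩
  · rintro h ⟨a, ha, b, hb, rfl⟩
    exact h a ha (by simpa using hb)

lemma missingSumCount_eq_sum (k : ℤ) (S : Finset ℤ) :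
    missingSumCount k S = ∑ A ∈ S.powerset, if ∀ a ∈ A, k - a ∉ A then 1 else 0 := by
  simp only [missingSumCount, notMem_add_self_iff, Finset.card_filter]

lemma missingSumCount_empty (k : ℤ) : missingSumCount k ∅ = 1 := by
  rw [missingSumCount_eq_sum, Finset.powerset_empty, Finset.sum_singleton, if_pos (by simp)]

lemma missingSumCount_insert_of_notMem {k x : ℤ} {S : Finset ℤ} (hx : x ∉ S)
    (hkx : k - x ∉ insert x S) :
    missingSumCount k (insert x S) = 2 * missingSumCount k S := by
  simp only [missingSumCount_eq_sum]
  rw [Finset.sum_powerset_insert hx, two_mul]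
  congr 1
  refine Finset.sum_congr rfl fun A hA => if_congr ?_ rfl rfl
  rw [Finset.mem_powerset] at hA
  simp only [Finset.mem_insert, not_or] at hkx ⊢
  constructor
  · exact fun h a ha => (h a (Or.inr ha)).2
  · rintro h a (rfl | ha)
    · exact ⟨hkx.1, fun h' => hkx.2 (hA h')⟩
    · refine ⟨fun h' => hkx.2 (hA ?_), h a ha⟩
      rwa [← h', sub_sub_cancel]

lemma missingSumCount_insert_half {k x : ℤ} {S : Finset ℤ} (hx : x ∉ S) (hkx : k - x = x) :
    missingSumCount k (insert x S) = missingSumCount k S := by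
  simp only [missingSumCount_eq_sum]
  rw [Finset.sum_powerset_insert hx, Nat.add_eq_left]
  refine Finset.sum_eq_zero fun A _ => if_neg fun h => ?_
  exact h x (by simp) (by simp [hkx])

lemma missingSumCount_insert_pair {k x y : ℤ} {S : Finset ℤ} (hx : x ∉ S) (hy : y ∉ S)
    (hxy : x ≠ y) (hk : x + y = k) :
    missingSumCount k (insert x (insert y S)) = 3 * missingSumCount k S := by
  subst hk
  have aux : ∀ z w : ℤ, z ∉ S → w ∉ S → z ≠ w → z + w = x + y → ∀ A ∈ S.powerset,
      (if ∀ a ∈ insert z A, x + y - a ∉ insert z A then 1 else 0)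
        = if ∀ a ∈ A, x + y - a ∉ A then 1 else 0 := by
    intro z w hz hw hzw hs A hA
    rw [Finset.mem_powerset] at hA
    refine if_congr ?_ rfl rfl
    simp only [Finset.mem_insert, not_or]
    constructor
    · exact fun h a ha => (h a (Or.inr ha)).2
    · rintro h a (rfl | ha)
      · rw [← hs, add_sub_cancel_left]
        exact ⟨hzw.symm, fun h' => hw (hA h')⟩
      · refine ⟨fun h' => hw (hA ?_), h a ha⟩
        rwa [show w = a by omega]
  simp only [missingSumCount_eq_sum]
  rw [Finset.sum_powerset_insert (by simp [hx, hxy]), Finset.sum_powerset_insert hy,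
    Finset.sum_powerset_insert hy, Finset.sum_congr rfl (aux y x hy hx hxy.symm (add_comm _ _)),
    Finset.sum_congr rfl (aux x y hx hy hxy rfl), Finset.sum_eq_zero (s := S.powerset)
      (f := fun A => if ∀ a ∈ insert x (insert y A), x + y - a ∉ insert x (insert y A)
        then 1 else 0)]
  · ring
  · exact fun A _ => if_neg fun h => h x (by simp) (by simp)

lemma missingSumCount_union {k : ℤ} {S T : Finset ℤ} (hST : Disjoint T S)
    (h : ∀ x ∈ T, k - x ∉ T ∪ S) :
    missingSumCount k (T ∪ S) = 2 ^ T.card * missingSumCount k S := by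
  induction T using Finset.induction_on with
  | empty => simp
  | insert x T hx ih =>
    rw [Finset.disjoint_insert_left] at hST
    rw [Finset.insert_union] at h ⊢
    rw [missingSumCount_insert_of_notMem (by simp [hx, hST.1]) (h x (by simp)),
      ih hST.2 fun y hy h' => h y (by simp [hy]) (by simp [Finset.mem_union.1 h']),
      Finset.card_insert_of_notMem hx]
    ring

lemma missingSumCount_Icc_odd (m : ℤ) (j : ℕ) :
    missingSumCount (2 * m + 1) (Finset.Icc (m + 1 - j) (m + j)) = 3 ^ j := by
  induction j with
  | zero => simp [missingSumCount_empty]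
  | succ j ih =>
    have hI : Finset.Icc (m + 1 - (j + 1 : ℕ)) (m + (j + 1 : ℕ))
        = insert (m - j) (insert (m + j + 1) (Finset.Icc (m + 1 - j) (m + j))) := by
      ext x
      simp only [Finset.mem_Icc, Finset.mem_insert]
      omega
    rw [hI, missingSumCount_insert_pair, ih, pow_succ, mul_comm] <;>
      first | omega | (rw [Finset.mem_Icc]; omega)

lemma missingSumCount_Icc_even (m : ℤ) (j : ℕ) :
    missingSumCount (2 * m) (Finset.Icc (m - j) (m + j)) = 3 ^ j := by
  induction j with
  | zero =>
    have h := missingSumCount_insert_half (k := 2 * m) (x := m) (S := ∅) (by simp) (by ring)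
    simpa [missingSumCount_empty] using h
  | succ j ih =>
    have hI : Finset.Icc (m - (j + 1 : ℕ)) (m + (j + 1 : ℕ))
        = insert (m - j - 1) (insert (m + j + 1) (Finset.Icc (m - j) (m + j))) := by
      ext x
      simp only [Finset.mem_Icc, Finset.mem_insert]
      omega
    rw [hI, missingSumCount_insert_pair, ih, pow_succ, mul_comm] <;>
      first | omega | (rw [Finset.mem_Icc]; omega)

lemma missingSumCount_Icc_of_le {k n : ℤ} (hk : 0 ≤ k) (hkn : k ≤ n - 1) :
    missingSumCount k (Finset.Icc 0 (n - 1))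
      = 2 ^ (n - 1 - k).toNat * missingSumCount k (Finset.Icc 0 k) := by
  have hI : Finset.Icc 0 (n - 1) = Finset.Icc (k + 1) (n - 1) ∪ Finset.Icc 0 k := by
    ext x
    simp only [Finset.mem_Icc, Finset.mem_union]
    omega
  rw [hI, missingSumCount_union, Int.card_Icc]
  · congr 3
    ring
  · rw [Finset.disjoint_left]
    simp only [Finset.mem_Icc]
    omega
  · simp only [Finset.mem_Icc, Finset.mem_union]
    omega

lemma missingSumCount_Icc_of_ge {k n : ℤ} (hkn : n - 1 ≤ k) (hk : k ≤ 2 * n - 2) :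
    missingSumCount k (Finset.Icc 0 (n - 1))
      = 2 ^ (k - n + 1).toNat * missingSumCount k (Finset.Icc (k - n + 1) (n - 1)) := by
  have hI : Finset.Icc 0 (n - 1)
      = Finset.Icc 0 (k - n) ∪ Finset.Icc (k - n + 1) (n - 1) := by
    ext x
    simp only [Finset.mem_Icc, Finset.mem_union]
    omega
  rw [hI, missingSumCount_union, Int.card_Icc]
  · congr 3
    ring
  · rw [Finset.disjoint_left]
    simp only [Finset.mem_Icc]
    omega
  · simp only [Finset.mem_Icc, Finset.mem_union]
    omega

lemma two_pow_mul_three_pow_div_odd {n r j : ℕ} (h : n = r + 2 * j) :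
    ((2 ^ r * 3 ^ j : ℕ) : ℝ) / 2 ^ n = (3 / 4) ^ j := by
  subst h
  rw [pow_add, pow_mul, div_pow]
  norm_num
  field_simp

lemma two_pow_mul_three_pow_div_even {n r j : ℕ} (h : n = r + 2 * j + 1) :
    ((2 ^ r * 3 ^ j : ℕ) : ℝ) / 2 ^ n = 1 / 2 * (3 / 4) ^ j := by
  rw [← two_pow_mul_three_pow_div_odd rfl, h, pow_succ]
  field_simp

theorem prob_sum_missing_totally_random (n : ℕ) (hn : 0 < n) :
    (∀ k : ℤ, 0 ≤ k → k ≤ (n : ℤ) - 1 →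
      (((Finset.Icc (0 : ℤ) ((n : ℤ) - 1)).powerset.filter
          (fun A : Finset ℤ => k ∉ A + A)).card : ℝ) / 2 ^ n
        = if Odd k then (3 / 4 : ℝ) ^ ((k + 1) / 2)
          else (1 / 2 : ℝ) * (3 / 4 : ℝ) ^ (k / 2)) ∧
    (∀ k : ℤ, (n : ℤ) - 1 ≤ k → k ≤ 2 * (n : ℤ) - 2 →
      (((Finset.Icc (0 : ℤ) ((n : ℤ) - 1)).powerset.filter
          (fun A : Finset ℤ => k ∉ A + A)).card : ℝ) / 2 ^ n
        = if Odd k then (3 / 4 : ℝ) ^ ((n : ℤ) - (k + 1) / 2)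
          else (1 / 2 : ℝ) * (3 / 4 : ℝ) ^ ((n : ℤ) - 1 - k / 2)) := by
  constructor
  · intro k hk hkn
    change (missingSumCount k (Finset.Icc 0 (n - 1)) : ℝ) / 2 ^ n = _
    rw [missingSumCount_Icc_of_le hk hkn]
    split_ifs with hodd
    · obtain ⟨m, rfl⟩ := hodd
      lift m to ℕ using by omega
      have h := missingSumCount_Icc_odd m (m + 1)
      rw [show (m : ℤ) + 1 - (m + 1 : ℕ) = 0 by omega,
        show (m : ℤ) + (m + 1 : ℕ) = 2 * m + 1 by omega] at h
      rw [h, two_pow_mul_three_pow_div_odd (by omega), ← zpow_natCast]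
      congr 1
      omega
    · obtain ⟨m, rfl⟩ := even_iff_two_dvd.1 (Int.not_odd_iff_even.1 hodd)
      lift m to ℕ using by omega
      have h := missingSumCount_Icc_even m m
      rw [sub_self, ← two_mul] at h
      rw [h, two_pow_mul_three_pow_div_even (by omega), ← zpow_natCast]
      congr 2
      omega
  · intro k hkn hk
    change (missingSumCount k (Finset.Icc 0 (n - 1)) : ℝ) / 2 ^ n = _
    rw [missingSumCount_Icc_of_ge hkn hk]
    split_ifs with hodd
    · obtain ⟨m, rfl⟩ := hodd
      have h := missingSumCount_Icc_odd m (n - 1 - m).toNat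
      rw [show m + 1 - ((n - 1 - m).toNat : ℤ) = 2 * m + 1 - n + 1 by omega,
        show m + ((n - 1 - m).toNat : ℤ) = n - 1 by omega] at h
      rw [h, two_pow_mul_three_pow_div_odd (by omega), ← zpow_natCast]
      congr 1
      omega
    · obtain ⟨m, rfl⟩ := even_iff_two_dvd.1 (Int.not_odd_iff_even.1 hodd)
      have h := missingSumCount_Icc_even m (n - 1 - m).toNat
      rw [show m - ((n - 1 - m).toNat : ℤ) = 2 * m - n + 1 by omega,
        show m + ((n - 1 - m).toNat : ℤ) = n - 1 by omega] at h
      rw [h, two_pow_mul_three_pow_div_even (by omega), ← zpow_natCast]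
      congr 2
      omega
end

section
/- Let n, ℓ, u be nonnegative integers with n ≥ ℓ+u, and fix L ⊆ {0,...,ℓ−1} and U ⊆ {n−u,...,n−1}. Then the number of subsets R ⊆ {ℓ,...,n−u−1} such that, with A = L∪R∪U, the set A+A contains every integer in {2ℓ−1,...,n−u−1} ∪ {n+ℓ−1,...,2n−2u−1}, is greater than (1 − 6·(2^{−|L|} + 2^{−|U|}))·2^{n−ℓ−u}. -/
open Finset Pointwise

/-- An upper bound for the probability that a random subset of an interval of `m` integers contains
no two (possibly equal) elements that are mirror images in that interval. -/
noncomputable def mirrorProb : ℕ → ℝ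
  | 0 => 1
  | 1 => 1 / 2
  | m + 2 => 3 / 4 * mirrorProb m

theorem mirrorProb_pos : ∀ m, 0 < mirrorProb m
  | 0 => by norm_num [mirrorProb]
  | 1 => by norm_num [mirrorProb]
  | m + 2 => by
    have := mirrorProb_pos m
    rw [mirrorProb]
    positivity

theorem sum_range_mirrorProb (M : ℕ) :
    ∑ m ∈ range M, mirrorProb m + 4 * (mirrorProb M + mirrorProb (M + 1)) = 6 := by
  induction M with
  | zero => norm_num [mirrorProb]
  | succ M ih =>
    rw [sum_range_succ, show mirrorProb (M + 1 + 1) = 3 / 4 * mirrorProb M from rfl]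
    linarith

theorem sum_mirrorProb_lt {ι : Type*} (I : Finset ι) (g : ι → ℕ) (hg : Set.InjOn g I) :
    ∑ k ∈ I, mirrorProb (g k) < 6 := by
  rw [← sum_image hg]
  obtain ⟨M, hM⟩ := (I.image g).exists_nat_subset_range
  have h1 : ∑ m ∈ I.image g, mirrorProb m ≤ ∑ m ∈ range M, mirrorProb m :=
    sum_le_sum_of_subset_of_nonneg hM fun m _ _ => (mirrorProb_pos m).le
  linarith [sum_range_mirrorProb M, mirrorProb_pos M, mirrorProb_pos (M + 1)]

/-- The subsets of `M` that avoid `T` and contain no two elements of the interval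
`[a, a + m - 1]` that are mirror images in it. -/
noncomputable def mirrorFree (M T : Finset ℤ) (a : ℤ) (m : ℕ) : Finset (Finset ℤ) :=
  {R ∈ M.powerset | Disjoint R T ∧ ∀ i ∈ Icc a (a + m - 1), i ∈ R → 2 * a + m - 1 - i ∉ R}

theorem card_mirrorFree_zero_le (M T : Finset ℤ) (a : ℤ) (hT : T ⊆ M) :
    ((mirrorFree M T a 0).card : ℝ) ≤ 2 ^ M.card * (1 / 2) ^ T.card := by
  have hsub : mirrorFree M T a 0 ⊆ (M \ T).powerset := by
    intro R hR
    simp only [mirrorFree, mem_filter, mem_powerset] at hR ⊢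
    exact subset_sdiff.2 ⟨hR.1, hR.2.1⟩
  have hcard := card_le_card hsub
  rw [card_powerset] at hcard
  have hsum := card_sdiff_add_card_eq_card hT
  calc ((mirrorFree M T a 0).card : ℝ) ≤ 2 ^ (M \ T).card := by exact_mod_cast hcard
    _ = 2 ^ M.card * (1 / 2) ^ T.card := by
      rw [← hsum, pow_add, mul_assoc, ← mul_pow]
      norm_num

theorem card_mirrorFree_add_two_le (M T : Finset ℤ) (a : ℤ) (m : ℕ) :
    (mirrorFree M T a (m + 2)).card ≤
      3 * (mirrorFree (M \ {a, a + m + 1}) T (a + 1) m).card := by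
  have hthree : (({∅, {a}, {a + m + 1}} : Finset (Finset ℤ))).card ≤ 3 := card_le_three
  refine le_trans ?_ (Nat.mul_le_mul_right _ hthree)
  rw [← card_product]
  refine card_le_card_of_injOn (fun R => (R ∩ {a, a + m + 1}, R \ {a, a + m + 1})) ?_ ?_
  · intro R hR
    simp only [mirrorFree, coe_filter, mem_powerset, Set.mem_ofPred_eq, mem_Icc] at hR
    obtain ⟨hRM, hRT, hpair⟩ := hR
    have hends : a ∈ R → a + m + 1 ∉ R := by
      have := hpair a (by push_cast; omega)
      convert this using 3
      push_cast; ring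
    simp only [mirrorFree, mem_coe, mem_product, mem_filter, mem_powerset]
    refine ⟨?_, sdiff_subset_sdiff hRM subset_rfl, hRT.mono_left sdiff_subset, ?_⟩
    · by_cases ha : a ∈ R
      · simp [inter_insert_of_mem ha, inter_singleton_of_notMem (hends ha)]
      · by_cases hb : a + m + 1 ∈ R
        · simp [inter_insert_of_notMem ha, inter_singleton_of_mem hb]
        · simp [inter_insert_of_notMem ha, inter_singleton_of_notMem hb]
    · intro i hi hiR hjR
      rw [mem_Icc] at hi
      refine hpair i (by push_cast; omega) (mem_sdiff.1 hiR).1 ?_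
      convert (mem_sdiff.1 hjR).1 using 1
      push_cast; ring
  · intro R _ S _ hRS
    simp only [Prod.mk.injEq] at hRS
    rw [← sdiff_union_inter R {a, a + m + 1}, hRS.1, hRS.2, sdiff_union_inter]

theorem card_mirrorFree_le (m : ℕ) (M T : Finset ℤ) (a : ℤ) (hM : Icc a (a + m - 1) ⊆ M)
    (hT : T ⊆ M) (hd : Disjoint T (Icc a (a + m - 1))) :
    ((mirrorFree M T a m).card : ℝ) ≤ mirrorProb m * (2 ^ M.card * (1 / 2) ^ T.card) := by
  induction m using Nat.twoStepInduction generalizing M T a with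
  | zero => simpa [mirrorProb] using card_mirrorFree_zero_le M T a hT
  | one =>
    have haI : a ∈ Icc a (a + (1 : ℕ) - 1) := by simp
    have haT : a ∉ T := fun h => disjoint_left.1 hd h haI
    have hsub : mirrorFree M T a 1 ⊆ mirrorFree M (insert a T) a 0 := by
      intro R hR
      simp only [mirrorFree, mem_filter] at hR ⊢
      obtain ⟨hRM, hRT, hpair⟩ := hR
      have haR : a ∉ R := fun h => hpair a haI h (by convert h using 1; push_cast; ring)
      refine ⟨hRM, disjoint_insert_right.2 ⟨haR, hRT⟩, ?_⟩
      intro i hi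
      simp at hi
    calc ((mirrorFree M T a 1).card : ℝ) ≤ (mirrorFree M (insert a T) a 0).card := by
          exact_mod_cast card_le_card hsub
      _ ≤ 2 ^ M.card * (1 / 2) ^ (insert a T).card :=
          card_mirrorFree_zero_le M _ a (insert_subset (hM haI) hT)
      _ = mirrorProb 1 * (2 ^ M.card * (1 / 2) ^ T.card) := by
          rw [card_insert_of_notMem haT, mirrorProb]
          ring
  | more m ih _ =>
    have hne : a ≠ a + m + 1 := by omega
    have hends : {a, a + (m : ℤ) + 1} ⊆ Icc a (a + (m + 2 : ℕ) - 1) := by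
      intro i hi
      simp only [mem_insert, mem_singleton] at hi
      rw [mem_Icc]
      push_cast
      omega
    have hinner : Icc (a + 1) (a + 1 + m - 1) ⊆ Icc a (a + (m + 2 : ℕ) - 1) :=
      Icc_subset_Icc (by omega) (by push_cast; omega)
    have hcard : (M \ {a, a + (m : ℤ) + 1}).card + 2 = M.card := by
      rw [← card_pair hne, card_sdiff_add_card_eq_card (hends.trans hM)]
    have hrec := ih (M \ {a, a + (m : ℤ) + 1}) T (a + 1)
      (subset_sdiff.2 ⟨hinner.trans hM, by
        rw [disjoint_left]
        intro i hi hi'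
        simp only [mem_insert, mem_singleton] at hi'
        rw [mem_Icc] at hi
        omega⟩)
      (subset_sdiff.2 ⟨hT, hd.mono_right hends⟩) (hd.mono_right hinner)
    calc ((mirrorFree M T a (m + 2)).card : ℝ)
        ≤ 3 * (mirrorFree (M \ {a, a + m + 1}) T (a + 1) m).card := by
          exact_mod_cast card_mirrorFree_add_two_le M T a m
      _ ≤ 3 * (mirrorProb m * (2 ^ (M \ {a, a + (m : ℤ) + 1}).card * (1 / 2) ^ T.card)) := by
          gcongr
      _ = mirrorProb (m + 2) * (2 ^ M.card * (1 / 2) ^ T.card) := by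
          rw [← hcard, mirrorProb]
          ring

theorem card_filter_notMem_add_self_le (M L U X : Finset ℤ) (k a : ℤ) (m : ℕ)
    (hk : k = 2 * a + m - 1) (hX : X ⊆ L ∪ U) (hM : Icc a (a + m - 1) ⊆ M)
    (hXM : ∀ x ∈ X, k - x ∈ M) (hXI : ∀ x ∈ X, k - x ∉ Icc a (a + m - 1)) :
    (({R ∈ M.powerset | k ∉ (L ∪ R ∪ U) + (L ∪ R ∪ U)}.card : ℕ) : ℝ) ≤
      mirrorProb m * (2 ^ M.card * (1 / 2) ^ X.card) := by
  have hcardX : (X.image (k - ·)).card = X.card := card_image_of_injective _ sub_right_injective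
  rw [← hcardX]
  refine le_trans ?_ (card_mirrorFree_le m M (X.image (k - ·)) a hM ?_ ?_)
  · refine Nat.cast_le.2 (card_le_card fun R hR => ?_)
    simp only [mirrorFree, mem_filter] at hR ⊢
    obtain ⟨hRM, hkR⟩ := hR
    refine ⟨hRM, ?_, fun i _ hi hj => hkR ?_⟩
    · rw [disjoint_left]
      intro y hy hyX
      obtain ⟨x, hx, rfl⟩ := mem_image.1 hyX
      refine hkR (mem_add.2 ⟨x, ?_, k - x, ?_, by ring⟩)
      · have := hX hx
        simp only [mem_union] at this ⊢
        tauto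
      · simp only [mem_union]
        tauto
    · refine mem_add.2 ⟨i, ?_, _, ?_, show i + (2 * a + m - 1 - i) = k by rw [hk]; ring⟩ <;>
        simp only [mem_union] <;> tauto
  · exact image_subset_iff.2 hXM
  · rw [disjoint_left]
    intro y hy
    obtain ⟨x, hx, rfl⟩ := mem_image.1 hy
    exact hXI x hx

theorem prop_sums (n ℓ u : ℕ) (h : ℓ + u ≤ n) (L U : Finset ℤ)
    (hL : L ⊆ Finset.Icc (0 : ℤ) ((ℓ : ℤ) - 1))
    (hU : U ⊆ Finset.Icc ((n : ℤ) - u) ((n : ℤ) - 1)) :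
    (((Finset.Icc ((ℓ : ℤ)) ((n : ℤ) - u - 1)).powerset.filter
        (fun R : Finset ℤ =>
          Finset.Icc (2 * (ℓ : ℤ) - 1) ((n : ℤ) - u - 1) ∪
            Finset.Icc ((n : ℤ) + ℓ - 1) (2 * (n : ℤ) - 2 * u - 1)
            ⊆ (L ∪ R ∪ U) + (L ∪ R ∪ U))).card : ℝ)
      > (1 - 6 * ((1 / 2 : ℝ) ^ L.card + (1 / 2 : ℝ) ^ U.card)) * 2 ^ (n - ℓ - u) := by
  set M := Icc (ℓ : ℤ) ((n : ℤ) - u - 1) with hMdef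
  set I := Icc (2 * (ℓ : ℤ) - 1) ((n : ℤ) - u - 1) with hI
  set J := Icc ((n : ℤ) + ℓ - 1) (2 * (n : ℤ) - 2 * u - 1) with hJ
  let bad : ℤ → Finset (Finset ℤ) := fun k => {R ∈ M.powerset | k ∉ (L ∪ R ∪ U) + (L ∪ R ∪ U)}
  have hMcard : M.card = n - ℓ - u := by
    rw [hMdef, Int.card_Icc]
    omega
  have hlow : ∀ k ∈ I, ((bad k).card : ℝ) ≤
      mirrorProb (k - 2 * ℓ + 1).toNat * (2 ^ M.card * (1 / 2) ^ L.card) := by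
    intro k hk
    rw [hI, mem_Icc] at hk
    refine card_filter_notMem_add_self_le M L U L k ℓ _ (by omega) subset_union_left
      (Icc_subset_Icc le_rfl (by omega)) ?_ ?_ <;>
    · intro x hx
      have := mem_Icc.1 (hL hx)
      simp only [hMdef, mem_Icc]
      omega
  have hhigh : ∀ k ∈ J, ((bad k).card : ℝ) ≤
      mirrorProb (2 * n - 2 * u - 1 - k).toNat * (2 ^ M.card * (1 / 2) ^ U.card) := by
    intro k hk
    rw [hJ, mem_Icc] at hk
    refine card_filter_notMem_add_self_le M L U U k (k - (n - u - 1)) _ (by omega)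
      subset_union_right (Icc_subset_Icc (by omega) (by omega)) ?_ ?_ <;>
    · intro x hx
      have := mem_Icc.1 (hU hx)
      simp only [hMdef, mem_Icc]
      omega
  have hIsum : ∑ k ∈ I, mirrorProb (k - 2 * ℓ + 1).toNat < 6 := by
    refine sum_mirrorProb_lt I _ fun x hx y hy hxy => ?_
    simp only [hI, coe_Icc, Set.mem_Icc] at hx hy hxy
    omega
  have hJsum : ∑ k ∈ J, mirrorProb (2 * n - 2 * u - 1 - k).toNat < 6 := by
    refine sum_mirrorProb_lt J _ fun x hx y hy hxy => ?_
    simp only [hJ, coe_Icc, Set.mem_Icc] at hx hy hxy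
    omega
  set good := M.powerset.filter fun R => I ∪ J ⊆ (L ∪ R ∪ U) + (L ∪ R ∪ U) with hgood
  have hcover : M.powerset ⊆ good ∪ (I.biUnion bad ∪ J.biUnion bad) := by
    intro R hR
    by_cases hRg : I ∪ J ⊆ (L ∪ R ∪ U) + (L ∪ R ∪ U)
    · exact mem_union_left _ (mem_filter.2 ⟨hR, hRg⟩)
    · obtain ⟨k, hk, hkR⟩ := not_subset.1 hRg
      refine mem_union_right _ ?_
      rw [← union_biUnion]
      exact mem_biUnion.2 ⟨k, hk, mem_filter.2 ⟨hR, hkR⟩⟩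
  have hcount : M.powerset.card ≤ good.card + (∑ k ∈ I, (bad k).card + ∑ k ∈ J, (bad k).card) :=
    (card_le_card hcover).trans <| (card_union_le _ _).trans <| Nat.add_le_add_left
      ((card_union_le _ _).trans (Nat.add_le_add card_biUnion_le card_biUnion_le)) _
  have hcount' : (2 : ℝ) ^ M.card ≤
      good.card + (∑ k ∈ I, ((bad k).card : ℝ) + ∑ k ∈ J, ((bad k).card : ℝ)) := by
    rw [card_powerset] at hcount
    exact_mod_cast hcount
  have hIbad := sum_le_sum hlow
  have hJbad := sum_le_sum hhigh
  rw [← sum_mul] at hIbad hJbad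
  have hLpos : (0 : ℝ) < 2 ^ M.card * (1 / 2) ^ L.card := by positivity
  have hUpos : (0 : ℝ) < 2 ^ M.card * (1 / 2) ^ U.card := by positivity
  have hIlt := mul_lt_mul_of_pos_right hIsum hLpos
  have hJlt := mul_lt_mul_of_pos_right hJsum hUpos
  rw [← hMcard, gt_iff_lt]
  linarith
end

section
/- Let n, ℓ, u be nonnegative integers with n ≥ ℓ+u, fix L ⊆ {0,...,ℓ−1} and U ⊆ {n−u,...,n−1}, and let k be an integer with n/2 ≤ k ≤ n−u−ℓ. Then the number of subsets R ⊆ {ℓ,...,n−u−1} such that k is not in (L∪R∪U)−(L∪R∪U), divided by 2^{n−ℓ−u}, equals (1/2)^{|L|+|U|}·(3/4)^{n−ℓ−u−k}. -/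
open Finset Pointwise

theorem four_pow_mul_card_powerset_filter_pairs {α : Type*} [DecidableEq α] {f : α → α}
    (hf : Function.Injective f) (D : Finset α) :
    ∀ S : Finset α, D ⊆ S → D.image f ⊆ S → Disjoint D (D.image f) →
      4 ^ D.card * (S.powerset.filter (fun R => ∀ x ∈ D, ¬(x ∈ R ∧ f x ∈ R))).card
        = 3 ^ D.card * 2 ^ S.card := by
  induction D using Finset.induction_on with
  | empty => intro S _ _ _; simp
  | insert a D ha ih =>
    intro S hS hfS hdisj
    rw [Finset.disjoint_left] at hdisj
    simp only [Finset.mem_insert, Finset.mem_image, not_exists, not_and] at hdisj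
    have hfa : f a ≠ a := fun h => hdisj (Or.inl rfl) a (Or.inl rfl) h
    have hfaD : f a ∉ D := fun h => hdisj (Or.inr h) a (Or.inl rfl) rfl
    have hfDa : ∀ x ∈ D, f x ≠ a := fun x hx h => hdisj (Or.inl rfl) x (Or.inr hx) h
    obtain ⟨T, hT⟩ : ∃ T, T = (S.erase a).erase (f a) := ⟨_, rfl⟩
    have haS : a ∈ S := hS (Finset.mem_insert_self a D)
    have hfaS : f a ∈ S := hfS (Finset.mem_image_of_mem f (Finset.mem_insert_self a D))
    have hST : S = insert a (insert (f a) T) := by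
      rw [hT, Finset.insert_erase (Finset.mem_erase.2 ⟨hfa, hfaS⟩), Finset.insert_erase haS]
    have hfaT : f a ∉ T := by simp [hT]
    have haT : a ∉ T := by simp [hT]
    have haT' : a ∉ insert (f a) T := by simp [haT, hfa.symm]
    have key := ih T
      (fun x hx => by
        have := hS (Finset.mem_insert_of_mem hx)
        simp only [hT, Finset.mem_erase]
        exact ⟨fun h => hfaD (h ▸ hx), fun h => ha (h ▸ hx), this⟩)
      (fun y hy => by
        obtain ⟨x, hx, rfl⟩ := Finset.mem_image.1 hy
        have := hfS (Finset.mem_image_of_mem f (Finset.mem_insert_of_mem hx))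
        simp only [hT, Finset.mem_erase]
        exact ⟨fun h => ha (hf h ▸ hx), hfDa x hx, this⟩)
      (by
        rw [Finset.disjoint_left]
        intro y hy hy'
        obtain ⟨x, hx, rfl⟩ := Finset.mem_image.1 hy'
        exact hdisj (Or.inr hy) x (Or.inr hx) rfl)
    rw [hST, Finset.card_insert_of_notMem haT', Finset.card_insert_of_notMem hfaT,
      Finset.card_insert_of_notMem ha, Finset.card_filter, Finset.sum_powerset_insert haT',
      Finset.sum_powerset_insert hfaT, Finset.sum_powerset_insert hfaT]
    rw [Finset.card_filter] at key
    have hmem : ∀ t ∈ T.powerset, a ∉ t ∧ f a ∉ t := fun t ht =>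
      ⟨fun h => haT (Finset.mem_powerset.1 ht h), fun h => hfaT (Finset.mem_powerset.1 ht h)⟩
    have hnone : ∑ t ∈ T.powerset, (if ∀ x ∈ insert a D, ¬(x ∈ t ∧ f x ∈ t) then 1 else 0)
        = ∑ t ∈ T.powerset, (if ∀ x ∈ D, ¬(x ∈ t ∧ f x ∈ t) then 1 else 0) := by
      refine Finset.sum_congr rfl fun t ht => if_congr ?_ rfl rfl
      simp [hmem t ht]
    have hsnd : ∑ t ∈ T.powerset, (if ∀ x ∈ insert a D,
          ¬(x ∈ insert (f a) t ∧ f x ∈ insert (f a) t) then 1 else 0)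
        = ∑ t ∈ T.powerset, (if ∀ x ∈ D, ¬(x ∈ t ∧ f x ∈ t) then 1 else 0) := by
      refine Finset.sum_congr rfl fun t ht => if_congr ?_ rfl rfl
      rw [Finset.forall_mem_insert]
      refine (and_iff_right ?_).trans (forall₂_congr fun x hx => ?_)
      · simp [(hmem t ht).1, hfa.symm]
      · have hx₁ : x ≠ f a := fun h => hfaD (h ▸ hx)
        have hx₂ : f x ≠ f a := fun h => ha (hf h ▸ hx)
        simp only [Finset.mem_insert, hx₁, hx₂, false_or]
    have hfst : ∑ t ∈ T.powerset, (if ∀ x ∈ insert a D,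
          ¬(x ∈ insert a t ∧ f x ∈ insert a t) then 1 else 0)
        = ∑ t ∈ T.powerset, (if ∀ x ∈ D, ¬(x ∈ t ∧ f x ∈ t) then 1 else 0) := by
      refine Finset.sum_congr rfl fun t ht => if_congr ?_ rfl rfl
      rw [Finset.forall_mem_insert]
      refine (and_iff_right ?_).trans (forall₂_congr fun x hx => ?_)
      · simp [(hmem t ht).2, hfa]
      · have hx₁ : x ≠ a := fun h => ha (h ▸ hx)
        simp only [Finset.mem_insert, hx₁, hfDa x hx, false_or]
    have hboth : ∑ t ∈ T.powerset, (if ∀ x ∈ insert a D,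
          ¬(x ∈ insert a (insert (f a) t) ∧ f x ∈ insert a (insert (f a) t)) then 1 else 0)
        = 0 := by
      refine Finset.sum_eq_zero fun t _ => if_neg fun h => ?_
      exact h a (Finset.mem_insert_self a D) (by simp)
    rw [hnone, hsnd, hfst, hboth, pow_succ, pow_succ, pow_succ, pow_succ]
    linear_combination 12 * key

theorem big_difference_notMem_iff {n ℓ u k : ℤ} {L R U : Finset ℤ}
    (hℓ : 0 ≤ ℓ) (hu : 0 ≤ u)
    (hL : L ⊆ Finset.Icc 0 (ℓ - 1)) (hU : U ⊆ Finset.Icc (n - u) (n - 1))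
    (hR : R ⊆ Finset.Icc ℓ (n - u - 1)) (hk1 : n ≤ 2 * k) (hk2 : k ≤ n - u - ℓ) :
    k ∉ (L ∪ R ∪ U) - (L ∪ R ∪ U) ↔
      Disjoint R (L.image (· + k) ∪ U.image (· - k)) ∧
        ∀ x ∈ Finset.Icc ℓ (n - u - 1 - k), ¬(x ∈ R ∧ x + k ∈ R) := by
  have hL' : ∀ x ∈ L, 0 ≤ x ∧ x ≤ ℓ - 1 := fun x hx => Finset.mem_Icc.1 (hL hx)
  have hU' : ∀ x ∈ U, n - u ≤ x ∧ x ≤ n - 1 := fun x hx => Finset.mem_Icc.1 (hU hx)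
  have hR' : ∀ x ∈ R, ℓ ≤ x ∧ x ≤ n - u - 1 := fun x hx => Finset.mem_Icc.1 (hR hx)
  rw [Finset.disjoint_right]
  constructor
  · intro h
    have h' : ∀ x, x ∈ L ∪ R ∪ U → x + k ∈ L ∪ R ∪ U → False := fun x hx hxk =>
      h (Finset.mem_sub.2 ⟨x + k, hxk, x, hx, by ring⟩)
    refine ⟨fun y hy hyR => ?_, fun x _ hx => h' x (by simp [hx.1]) (by simp [hx.2])⟩
    rcases Finset.mem_union.1 hy with hy | hy
    · obtain ⟨x, hx, rfl⟩ := Finset.mem_image.1 hy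
      exact h' x (by simp [hx]) (by simp [hyR])
    · obtain ⟨x, hx, rfl⟩ := Finset.mem_image.1 hy
      exact h' (x - k) (by simp [hyR]) (by simp [hx])
  · rintro ⟨hdisj, hpair⟩ h
    obtain ⟨y, hy, x, hx, hyx⟩ := Finset.mem_sub.1 h
    obtain rfl : y = x + k := by omega
    have hLk : ∀ z ∈ L, z + k ∉ R := fun z hz =>
      hdisj (Finset.mem_union_left _ (Finset.mem_image_of_mem (· + k) hz))
    have hUk : ∀ z ∈ U, z - k ∉ R := fun z hz =>
      hdisj (Finset.mem_union_right _ (Finset.mem_image_of_mem (· - k) hz))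
    simp only [Finset.mem_union] at hx hy
    rcases hx with (hx | hx) | hx <;> rcases hy with (hy | hy) | hy
    · have := hL' _ hx; have := hL' _ hy; omega
    · exact hLk x hx hy
    · have := hL' _ hx; have := hU' _ hy; omega
    · have := hR' _ hx; have := hL' _ hy; omega
    · have := hR' _ hx
      have := hR' _ hy
      exact hpair x (Finset.mem_Icc.2 (by omega)) ⟨hx, hy⟩
    · exact hUk _ hy (by simpa using hx)
    · have := hU' _ hx; have := hL' _ hy; omega
    · have := hU' _ hx; have := hR' _ hy; omega
    · have := hU' _ hx; have := hU' _ hy; omega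

theorem prob_big_difference_missing (n ℓ u : ℕ) (h : ℓ + u ≤ n) (L U : Finset ℤ)
    (hL : L ⊆ Finset.Icc (0 : ℤ) ((ℓ : ℤ) - 1))
    (hU : U ⊆ Finset.Icc ((n : ℤ) - u) ((n : ℤ) - 1))
    (k : ℤ) (hk1 : (n : ℤ) ≤ 2 * k) (hk2 : k ≤ (n : ℤ) - u - ℓ) :
    (((Finset.Icc ((ℓ : ℤ)) ((n : ℤ) - u - 1)).powerset.filter
        (fun R : Finset ℤ => k ∉ (L ∪ R ∪ U) - (L ∪ R ∪ U))).card : ℝ) / 2 ^ (n - ℓ - u)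
      = (1 / 2 : ℝ) ^ (L.card + U.card) * (3 / 4 : ℝ) ^ ((n : ℤ) - ℓ - u - k) := by
  have hL' : ∀ x ∈ L, 0 ≤ x ∧ x ≤ (ℓ : ℤ) - 1 := fun x hx => Finset.mem_Icc.1 (hL hx)
  have hU' : ∀ x ∈ U, (n : ℤ) - u ≤ x ∧ x ≤ (n : ℤ) - 1 := fun x hx => Finset.mem_Icc.1 (hU hx)
  set M := Finset.Icc (ℓ : ℤ) ((n : ℤ) - u - 1) with hM
  set D := Finset.Icc (ℓ : ℤ) ((n : ℤ) - u - 1 - k) with hD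
  set F := L.image (· + k) ∪ U.image (· - k) with hF
  have hF_mem : ∀ y ∈ F, y ∈ M ∧ y ∉ D ∧ ∀ x ∈ D, x + k ≠ y := by
    intro y hy
    simp only [hM, hD, Finset.mem_Icc]
    rcases Finset.mem_union.1 hy with hy | hy
    · obtain ⟨x, hx, rfl⟩ := Finset.mem_image.1 hy
      have := hL' x hx
      refine ⟨?_, ?_, ?_⟩ <;> intros <;> omega
    · obtain ⟨x, hx, rfl⟩ := Finset.mem_image.1 hy
      have := hU' x hx
      refine ⟨?_, ?_, ?_⟩ <;> intros <;> omega
  have hFM : F ⊆ M := fun y hy => (hF_mem y hy).1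
  have hFcard : F.card = L.card + U.card := by
    rw [hF, Finset.card_union_of_disjoint, Finset.card_image_of_injective _ (add_left_injective k),
      Finset.card_image_of_injective _ sub_left_injective]
    rw [Finset.disjoint_left]
    intro y hy hy'
    obtain ⟨x, hx, rfl⟩ := Finset.mem_image.1 hy
    obtain ⟨z, hz, hzx⟩ := Finset.mem_image.1 hy'
    have := hL' x hx
    have := hU' z hz
    omega
  have hMcard : M.card = n - ℓ - u := by
    rw [hM, Int.card_Icc]; omega
  have hDcard : (D.card : ℤ) = (n : ℤ) - ℓ - u - k := by
    rw [hD, Int.card_Icc]; omega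
  have hfilter : M.powerset.filter (fun R : Finset ℤ => k ∉ (L ∪ R ∪ U) - (L ∪ R ∪ U))
      = (M \ F).powerset.filter (fun R => ∀ x ∈ D, ¬(x ∈ R ∧ x + k ∈ R)) := by
    ext R
    simp only [Finset.mem_filter, Finset.mem_powerset, Finset.subset_sdiff, and_assoc]
    exact and_congr_right fun hR =>
      big_difference_notMem_iff (Int.natCast_nonneg ℓ) (Int.natCast_nonneg u) hL hU hR hk1 hk2
  have hcount := four_pow_mul_card_powerset_filter_pairs (add_left_injective k) D (M \ F)
    (fun x hx => Finset.mem_sdiff.2 ⟨by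
      simp only [hM, hD, Finset.mem_Icc] at hx ⊢; omega, fun hxF => (hF_mem x hxF).2.1 hx⟩)
    (fun y hy => by
      obtain ⟨x, hx, rfl⟩ := Finset.mem_image.1 hy
      refine Finset.mem_sdiff.2 ⟨?_, fun hxF => (hF_mem _ hxF).2.2 x hx rfl⟩
      simp only [hM, hD, Finset.mem_Icc] at hx ⊢
      omega)
    (by
      rw [Finset.disjoint_left]
      intro y hy hy'
      obtain ⟨x, hx, rfl⟩ := Finset.mem_image.1 hy'
      simp only [hD, Finset.mem_Icc] at hx hy
      omega)
  have hcard : (M \ F).card + (L.card + U.card) = n - ℓ - u := by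
    rw [← hFcard, Finset.card_sdiff_add_card_eq_card hFM, hMcard]
  rw [hfilter, ← hDcard, zpow_natCast, ← hcard, pow_add, div_pow, div_pow, one_pow]
  have hcountR := congrArg (Nat.cast : ℕ → ℝ) hcount
  push_cast at hcountR
  field_simp
  linear_combination hcountR
end

section
/- Let a < b be integers and let k be an integer with 1 ≤ k ≤ 2(b−a)/3. Then the number of subsets R ⊆ {a,...,b−1} such that k is not in R−R is at most (3/4)^{(b−a)/3}·2^{b−a}. -/
open Finset Pointwise

/-- The number of subsets of `S` avoiding the difference `k` is controlled by a matching
`{(i, i + k) : i ∈ M}` inside `S`: each matched pair costs a factor `3 / 4`. -/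
lemma card_avoiding_difference_mul_le (k : ℤ) (hk : 1 ≤ k) (M : Finset ℤ) :
    ∀ S : Finset ℤ, (∀ i ∈ M, i ∈ S ∧ i + k ∈ S ∧ i + k ∉ M) →
      (S.powerset.filter (fun R : Finset ℤ => k ∉ R - R)).card * 4 ^ M.card
        ≤ 3 ^ M.card * 2 ^ S.card := by
  induction M using Finset.induction_on with
  | empty =>
    intro S _
    simpa using card_filter_le S.powerset (fun R : Finset ℤ => k ∉ R - R)
  | insert i M hi ih =>
    intro S hM
    have hiS := (hM i (by simp)).1
    have hikS := (hM i (by simp)).2.1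
    have hne : i ≠ i + k := by omega
    have hP : ({i, i + k} : Finset ℤ) ⊆ S := by
      intro x hx
      simp only [mem_insert, mem_singleton] at hx
      rcases hx with rfl | rfl <;> assumption
    have hcard : (S \ {i, i + k}).card + 2 = S.card := by
      have := card_sdiff_add_card_eq_card hP
      rwa [card_pair hne] at this
    have hrec := ih (S \ {i, i + k}) (by
      intro j hj
      obtain ⟨h1, h2, h3⟩ := hM j (mem_insert_of_mem hj)
      have h4 := (hM i (by simp)).2.2
      simp only [mem_insert, not_or] at h3 h4
      have h5 : j ≠ i := by rintro rfl; exact hi hj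
      have h6 : j ≠ i + k := by rintro rfl; exact h4.2 hj
      have h7 : j + k ≠ i + k := by omega
      simp only [mem_sdiff, mem_insert, mem_singleton, not_or]
      exact ⟨⟨h1, h5, h6⟩, ⟨h2, h3.1, h7⟩, h3.2⟩)
    have hsplit : (S.powerset.filter (fun R : Finset ℤ => k ∉ R - R)).card ≤
        (((S \ {i, i + k}).powerset.filter (fun R : Finset ℤ => k ∉ R - R)) ×ˢ
          ((({i, i + k} : Finset ℤ).powerset).erase {i, i + k})).card := by
      apply card_le_card_of_injOn (fun R => (R \ {i, i + k}, R ∩ {i, i + k}))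
      · intro R hR
        simp only [coe_filter, mem_powerset, Set.mem_ofPred_eq] at hR
        simp only [mem_coe, mem_product, mem_filter, mem_powerset, mem_erase]
        refine ⟨⟨sdiff_subset_sdiff hR.1 subset_rfl, fun h => hR.2 ?_⟩, fun h => hR.2 ?_,
          inter_subset_right⟩
        · exact sub_subset_sub sdiff_subset sdiff_subset h
        · have hs : ({i, i + k} : Finset ℤ) ⊆ R := inter_eq_right.mp h
          exact mem_sub.mpr ⟨i + k, hs (by simp), i, hs (by simp), by ring⟩
      · intro R _ R' _ h
        simp only [Prod.mk.injEq] at h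
        rw [← sdiff_union_inter R {i, i + k}, ← sdiff_union_inter R' {i, i + k}, h.1, h.2]
    have hthree : ((({i, i + k} : Finset ℤ).powerset).erase {i, i + k}).card = 3 := by
      rw [card_erase_of_mem (by simp), card_powerset, card_pair hne]
      norm_num
    rw [card_product, hthree] at hsplit
    rw [card_insert_of_notMem hi, ← hcard, pow_succ, pow_succ, pow_add]
    calc _ ≤ _ := Nat.mul_le_mul_right _ hsplit
      _ = ((((S \ {i, i + k}).powerset.filter
            (fun R : Finset ℤ => k ∉ R - R)).card) * 4 ^ M.card) * 12 := by ring
      _ ≤ _ := Nat.mul_le_mul_right 12 hrec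
      _ = _ := by ring

/-- An interval of length at least `3k/2` contains a matching by pairs at distance `k`
with at least a third as many edges as the interval has points. -/
lemma exists_large_difference_matching (a b k : ℤ) (hk1 : 1 ≤ k) (hk2 : 3 * k ≤ 2 * (b - a)) :
    ∃ M : Finset ℤ, (∀ i ∈ M, i ∈ Icc a (b - 1) ∧ i + k ∈ Icc a (b - 1) ∧ i + k ∉ M) ∧
      b - a ≤ 3 * M.card := by
  have hshift (i : ℤ) : (i + k - a) / k = (i - a) / k + 1 := by
    rw [show i + k - a = i - a + 1 * k by ring, Int.add_mul_ediv_right _ _ (by omega)]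
  rcases lt_or_ge (b - a) (2 * k) with h | h
  · refine ⟨Icc a (b - 1 - k), fun i hi => ?_, ?_⟩
    · simp only [mem_Icc] at hi ⊢
      omega
    · rw [Int.card_Icc]
      omega
  · let M := (Icc a (b - 1 - k)).filter (fun i => (i - a) / k % 2 = 0)
    have hmem (i : ℤ) : i ∈ M ↔ (a ≤ i ∧ i ≤ b - 1 - k) ∧ (i - a) / k % 2 = 0 := by
      simp [M]
    refine ⟨M, fun i hi => ?_, ?_⟩
    · rw [hmem] at hi ⊢
      simp only [mem_Icc, hshift]
      omega
    · have hcover : Icc a (b - 1) ⊆ M ∪ M.image (· + k) ∪ M.image (· + 2 * k) := by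
        intro x hx
        simp only [mem_Icc] at hx
        have hx1 := hshift (x - k)
        have hx2 := hshift (x - 2 * k)
        rw [show x - k + k - a = x - a by ring] at hx1
        rw [show x - 2 * k + k - a = x - k - a by ring] at hx2
        have hlow : x - a < k → (x - a) / k = 0 := fun h' =>
          Int.ediv_eq_zero_of_lt (by omega) h'
        have hlow' : x - k - a < k → k ≤ x - a → (x - k - a) / k = 0 := fun h' h'' =>
          Int.ediv_eq_zero_of_lt (by omega) h'
        simp only [mem_union, mem_image]
        by_cases hpar : (x - a) / k % 2 = 0
        · by_cases hend : x ≤ b - 1 - k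
          · exact Or.inl (Or.inl ((hmem x).2 ⟨⟨hx.1, hend⟩, hpar⟩))
          · refine Or.inr ⟨x - 2 * k, (hmem _).2 ?_, by ring⟩
            omega
        · refine Or.inl (Or.inr ⟨x - k, (hmem _).2 ?_, by ring⟩)
          omega
      have h1 := card_le_card hcover
      have h2 := card_union_le (M ∪ M.image (· + k)) (M.image (· + 2 * k))
      have h3 := card_union_le M (M.image (· + k))
      have h4 : (M.image (· + k)).card ≤ M.card := card_image_le
      have h5 : (M.image (· + 2 * k)).card ≤ M.card := card_image_le
      rw [Int.card_Icc] at h1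
      omega

theorem prob_small_difference_missing (a b : ℤ) (hab : a < b)
    (k : ℤ) (hk1 : 1 ≤ k) (hk2 : 3 * k ≤ 2 * (b - a)) :
    (((Finset.Icc a (b - 1)).powerset.filter
        (fun R : Finset ℤ => k ∉ R - R)).card : ℝ)
      ≤ (3 / 4 : ℝ) ^ (((b - a : ℤ) : ℝ) / 3) * 2 ^ (b - a) := by
  obtain ⟨M, hM, hcard⟩ := exists_large_difference_matching a b k hk1 hk2
  have hcount := card_avoiding_difference_mul_le k hk1 M (Icc a (b - 1)) hM
  have hsize : (((Icc a (b - 1)).card : ℕ) : ℤ) = b - a := by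
    rw [Int.card_Icc]
    omega
  have hcountR : (((Icc a (b - 1)).powerset.filter (fun R : Finset ℤ => k ∉ R - R)).card : ℝ)
      * 4 ^ M.card ≤ 3 ^ M.card * 2 ^ (Icc a (b - 1)).card := by exact_mod_cast hcount
  have hexp : ((b - a : ℤ) : ℝ) / 3 ≤ (M.card : ℝ) := by
    have : ((b - a : ℤ) : ℝ) ≤ 3 * (M.card : ℝ) := by exact_mod_cast hcard
    linarith
  have hpow : (3 / 4 : ℝ) ^ M.card ≤ (3 / 4 : ℝ) ^ (((b - a : ℤ) : ℝ) / 3) := by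
    rw [← Real.rpow_natCast]
    exact Real.rpow_le_rpow_of_exponent_ge (by norm_num) (by norm_num) hexp
  rw [← hsize] at hpow ⊢
  rw [zpow_natCast]
  calc _ ≤ (3 / 4 : ℝ) ^ M.card * 2 ^ (Icc a (b - 1)).card := by
        rw [div_pow, div_mul_eq_mul_div, le_div_iff₀ (by positivity)]
        exact hcountR
    _ ≤ _ := by gcongr
end

section
/- Let n be a positive integer. For an integer k with 1 ≤ k ≤ n/2, the number of subsets A ⊆ {0,...,n−1} with k ∉ A−A is at most (3/4)^{n/3}·2^n, and for an integer k with n/2 ≤ k ≤ n−1, the number of subsets A ⊆ {0,...,n−1} with k ∉ A−A equals exactly (3/4)^{n−k}·2^n. -/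
open Finset Pointwise

/-- The number of subsets of `U` that contain none of the pairs `{s, f s}`, `s ∈ S`, when these
pairs are pairwise disjoint subsets of `U`. -/
lemma card_filter_powerset_not_pair_mul {α : Type*} [DecidableEq α] (f : α → α) (S : Finset α) :
    ∀ U : Finset α, S ⊆ U → S.image f ⊆ U → Set.InjOn f S → Disjoint S (S.image f) →
      #{A ∈ U.powerset | ∀ s ∈ S, ¬(s ∈ A ∧ f s ∈ A)} * 4 ^ #S = 3 ^ #S * 2 ^ #U := by
  induction S using Finset.induction_on with
  | empty => intro U _ _ _ _; simp
  | insert a S ha ih =>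
    intro U hS hfS hinj hdisj
    rw [Finset.disjoint_left] at hdisj
    have haf : a ≠ f a := fun h =>
      hdisj (mem_insert_self a S) (mem_image.2 ⟨a, mem_insert_self a S, h.symm⟩)
    have hSa : ∀ s ∈ S, s ≠ a := fun s hs h => ha (h ▸ hs)
    have hSfa : ∀ s ∈ S, s ≠ f a := fun s hs h =>
      hdisj (mem_insert_of_mem hs) (mem_image.2 ⟨a, mem_insert_self a S, h.symm⟩)
    have hfSa : ∀ s ∈ S, f s ≠ a := fun s hs h =>
      hdisj (mem_insert_self a S) (mem_image.2 ⟨s, mem_insert_of_mem hs, h⟩)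
    have hfSfa : ∀ s ∈ S, f s ≠ f a := fun s hs h =>
      hSa s hs (hinj (by simp [hs]) (by simp) h)
    have haU : a ∈ U := hS (mem_insert_self a S)
    have hfaU : f a ∈ U := hfS (mem_image_of_mem f (mem_insert_self a S))
    obtain ⟨V, haV, hfaV, rfl⟩ : ∃ V, a ∉ V ∧ f a ∉ V ∧ U = insert a (insert (f a) V) := by
      refine ⟨(U.erase a).erase (f a), by simp, by simp, ?_⟩
      rw [insert_erase (mem_erase.2 ⟨haf.symm, hfaU⟩), insert_erase haU]
    have hV := ih V
      (fun s hs => by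
        have := hS (mem_insert_of_mem hs)
        simpa [hSa s hs, hSfa s hs] using this)
      (fun t ht => by
        obtain ⟨s, hs, rfl⟩ := mem_image.1 ht
        have := hfS (mem_image_of_mem f (mem_insert_of_mem hs))
        simpa [hfSa s hs, hfSfa s hs] using this)
      (hinj.mono (by simp))
      (Finset.disjoint_left.2 fun s hs hs' =>
        hdisj (mem_insert_of_mem hs) (image_subset_image (subset_insert a S) hs'))
    have haV' : a ∉ insert (f a) V := by simp [haf, haV]
    have key : #{A ∈ (insert a (insert (f a) V)).powerset |
          ∀ s ∈ insert a S, ¬(s ∈ A ∧ f s ∈ A)} =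
        3 * #{A ∈ V.powerset | ∀ s ∈ S, ¬(s ∈ A ∧ f s ∈ A)} := by
      simp only [card_filter]
      rw [sum_powerset_insert haV', sum_powerset_insert hfaV, sum_powerset_insert hfaV]
      have h (B : Finset α) (hB : B ⊆ ({a, f a} : Finset α)) (hB' : ¬(a ∈ B ∧ f a ∈ B))
          (A : Finset α) (hA : A ∈ V.powerset) :
          (∀ s ∈ insert a S, ¬(s ∈ B ∪ A ∧ f s ∈ B ∪ A)) ↔ ∀ s ∈ S, ¬(s ∈ A ∧ f s ∈ A) := by
        have hAa : a ∉ A := fun h => haV (mem_powerset.1 hA h)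
        have hAfa : f a ∉ A := fun h => hfaV (mem_powerset.1 hA h)
        have hmem : ∀ x, x ≠ a → x ≠ f a → x ∉ B := fun x h₁ h₂ hx => by
          simpa [h₁, h₂] using hB hx
        rw [forall_mem_insert]
        simp only [mem_union, hAa, hAfa, or_false, hB', not_false_eq_true, true_and]
        refine forall₂_congr fun s hs => ?_
        simp [hmem s (hSa s hs) (hSfa s hs), hmem (f s) (hfSa s hs) (hfSfa s hs)]
      have h₀ := fun A hA => h ∅ (by simp) (by simp) A hA
      have h₁ := fun A hA => h {a} (by simp) (by simp [haf.symm]) A hA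
      have h₂ := fun A hA => h {f a} (by simp) (by simp [haf]) A hA
      simp only [empty_union, singleton_union] at h₀ h₁ h₂
      rw [sum_congr rfl fun A hA => by rw [if_congr (h₀ A hA) rfl rfl],
        sum_congr (s₂ := V.powerset) (f := fun A => if ∀ s ∈ insert a S,
          ¬(s ∈ insert (f a) A ∧ f s ∈ insert (f a) A) then 1 else 0) rfl
          fun A hA => by rw [if_congr (h₂ A hA) rfl rfl],
        sum_congr (s₂ := V.powerset) (f := fun A => if ∀ s ∈ insert a S,
          ¬(s ∈ insert a A ∧ f s ∈ insert a A) then 1 else 0) rfl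
          fun A hA => by rw [if_congr (h₁ A hA) rfl rfl],
        sum_eq_zero (s := V.powerset) (f := fun A => if ∀ s ∈ insert a S,
          ¬(s ∈ insert a (insert (f a) A) ∧ f s ∈ insert a (insert (f a) A)) then 1 else 0)
          fun A _ => if_neg fun h => h a (mem_insert_self a S) (by simp)]
      ring
    rw [key, card_insert_of_notMem ha, card_insert_of_notMem haV', card_insert_of_notMem hfaV]
    linear_combination 12 * hV

/-- If `1 ≤ k ≤ n / 2`, then `{0, …, n - 1}` contains at least `n / 3` disjoint pairs
`{s, s + k}`. -/
lemma exists_card_disjoint_translate (k : ℤ) (hk : 1 ≤ k) (n : ℕ) (hn : 2 * k ≤ n) :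
    ∃ S : Finset ℤ, S ⊆ Icc 0 (n - 1 - k) ∧ Disjoint S (S.image (· + k)) ∧ n ≤ 3 * #S := by
  induction n using Nat.strong_induction_on with
  | _ n ih =>
    have hdisj {T : Finset ℤ} (hT : ∀ t ∈ T, 2 * k ≤ t) (hT' : Disjoint T (T.image (· + k))) :
        Disjoint (Ico 0 k ∪ T) ((Ico 0 k ∪ T).image (· + k)) := by
      rw [Finset.disjoint_left] at hT' ⊢
      intro x hx hx'
      obtain ⟨y, hy, rfl⟩ := mem_image.1 hx'
      simp only [mem_union, mem_Ico] at hx hy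
      rcases hx with hx | hx <;> rcases hy with hy | hy
      · lia
      · have := hT _ hy
        lia
      · have := hT _ hx
        lia
      · exact hT' hx (mem_image_of_mem _ hy)
    have hcard {T : Finset ℤ} (hT : ∀ t ∈ T, 2 * k ≤ t) :
        (#(Ico 0 k ∪ T) : ℤ) = k + #T := by
      rw [card_union_of_disjoint, Int.card_Ico]
      · push_cast
        lia
      · refine Finset.disjoint_left.2 fun x hx hx' => ?_
        have := hT x hx'
        rw [mem_Ico] at hx
        lia
    rcases lt_or_ge (n : ℤ) (4 * k) with h | h
    · have hT : ∀ t ∈ Ico (2 * k) (n - k), 2 * k ≤ t := fun t ht => (mem_Ico.1 ht).1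
      refine ⟨Ico 0 k ∪ Ico (2 * k) (n - k), ?_, hdisj hT ?_, ?_⟩
      · intro x
        simp only [mem_union, mem_Ico, mem_Icc]
        lia
      · refine Finset.disjoint_left.2 fun x hx hx' => ?_
        obtain ⟨y, hy, rfl⟩ := mem_image.1 hx'
        rw [mem_Ico] at hx hy
        lia
      · have := hcard hT
        rw [Int.card_Ico] at this
        lia
    · obtain ⟨S, hS, hSk, hSn⟩ := ih (n - 2 * k).toNat (by lia) (by lia)
      have hT : ∀ t ∈ S.image (· + 2 * k), 2 * k ≤ t := by
        intro t ht
        obtain ⟨s, hs, rfl⟩ := mem_image.1 ht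
        have := mem_Icc.1 (hS hs)
        lia
      refine ⟨Ico 0 k ∪ S.image (· + 2 * k), ?_, hdisj hT ?_, ?_⟩
      · intro x hx
        rcases mem_union.1 hx with hx | hx
        · rw [mem_Ico] at hx
          rw [mem_Icc]
          lia
        · obtain ⟨s, hs, rfl⟩ := mem_image.1 hx
          have := mem_Icc.1 (hS hs)
          rw [mem_Icc]
          lia
      · rw [Finset.disjoint_left] at hSk ⊢
        intro x hx hx'
        obtain ⟨s, hs, rfl⟩ := mem_image.1 hx
        obtain ⟨y, hy, hxy⟩ := mem_image.1 hx'
        obtain ⟨t, ht, rfl⟩ := mem_image.1 hy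
        exact hSk hs (mem_image.2 ⟨t, ht, by lia⟩)
      · have := hcard hT
        rw [card_image_of_injective _ (add_left_injective _)] at this
        lia

/-- The number of subsets of `{0, …, n - 1}` that contain none of the disjoint pairs
`{s, s + k}`, `s ∈ S`. -/
lemma card_filter_powerset_Icc_not_pair (n : ℕ) (k : ℤ) (hk : 0 ≤ k) (S : Finset ℤ)
    (hS : S ⊆ Icc 0 (n - 1 - k)) (hSk : Disjoint S (S.image (· + k))) :
    (#{A ∈ (Icc (0 : ℤ) (n - 1)).powerset | ∀ s ∈ S, ¬(s ∈ A ∧ s + k ∈ A)} : ℝ) =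
      (3 / 4) ^ #S * 2 ^ n := by
  have h := card_filter_powerset_not_pair_mul (· + k) S (Icc (0 : ℤ) (n - 1))
    (fun s hs => by
      have := mem_Icc.1 (hS hs)
      rw [mem_Icc]
      lia)
    (fun t ht => by
      obtain ⟨s, hs, rfl⟩ := mem_image.1 ht
      have := mem_Icc.1 (hS hs)
      rw [mem_Icc]
      lia)
    (add_left_injective k).injOn hSk
  rw [Int.card_Icc, show ((n : ℤ) - 1 + 1 - 0).toNat = n by lia] at h
  rw [div_pow, div_mul_eq_mul_div, eq_div_iff (by positivity)]
  exact_mod_cast h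

lemma notMem_sub_self_iff (A : Finset ℤ) (k : ℤ) :
    k ∉ A - A ↔ ∀ s, ¬(s ∈ A ∧ s + k ∈ A) := by
  rw [mem_sub]
  constructor
  · rintro h s ⟨hs, hsk⟩
    exact h ⟨s + k, hsk, s, hs, by ring⟩
  · rintro h ⟨a, ha, b, hb, rfl⟩
    exact h b ⟨hb, by simpa using ha⟩

theorem prob_difference_missing_totally_random (n : ℕ) (hn : 0 < n) :
    (∀ k : ℤ, 1 ≤ k → 2 * k ≤ (n : ℤ) →
      (((Finset.Icc (0 : ℤ) ((n : ℤ) - 1)).powerset.filter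
          (fun A : Finset ℤ => k ∉ A - A)).card : ℝ)
        ≤ (3 / 4 : ℝ) ^ ((n : ℝ) / 3) * 2 ^ n) ∧
    (∀ k : ℤ, (n : ℤ) ≤ 2 * k → k ≤ (n : ℤ) - 1 →
      (((Finset.Icc (0 : ℤ) ((n : ℤ) - 1)).powerset.filter
          (fun A : Finset ℤ => k ∉ A - A)).card : ℝ)
        = (3 / 4 : ℝ) ^ ((n : ℤ) - k) * 2 ^ n) := by
  refine ⟨fun k hk hkn => ?_, fun k hnk hkn => ?_⟩
  · obtain ⟨S, hS, hSk, hSn⟩ := exists_card_disjoint_translate k hk n hkn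
    calc _ ≤ (#{A ∈ (Icc (0 : ℤ) (n - 1)).powerset | ∀ s ∈ S, ¬(s ∈ A ∧ s + k ∈ A)} : ℝ) := by
          refine Nat.cast_le.2 (card_le_card (monotone_filter_right _ fun A _ hA s _ => ?_))
          exact (notMem_sub_self_iff A k).1 hA s
      _ = (3 / 4 : ℝ) ^ (#S : ℝ) * 2 ^ n := by
          rw [card_filter_powerset_Icc_not_pair n k (by lia) S hS hSk, Real.rpow_natCast]
      _ ≤ _ := by
          have hSn' : (n : ℝ) ≤ 3 * #S := by exact_mod_cast hSn
          refine mul_le_mul_of_nonneg_right ?_ (by positivity)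
          exact Real.rpow_le_rpow_of_exponent_ge (by norm_num) (by norm_num) (by linarith)
  · have h := card_filter_powerset_Icc_not_pair n k (by lia) (Icc 0 (n - 1 - k)) subset_rfl
      (Finset.disjoint_left.2 fun x hx hx' => by
        obtain ⟨y, hy, rfl⟩ := mem_image.1 hx'
        rw [mem_Icc] at hx hy
        lia)
    rw [Int.card_Icc, ← zpow_natCast,
      show (((n : ℤ) - 1 - k + 1 - 0).toNat : ℤ) = n - k by lia] at h
    rw [← h]
    congr 2
    refine filter_congr fun A hA => ?_
    rw [notMem_sub_self_iff]
    refine ⟨fun h s _ => h s, fun h s hs => h s ?_ hs⟩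
    have h₁ := mem_Icc.1 (mem_powerset.1 hA hs.1)
    have h₂ := mem_Icc.1 (mem_powerset.1 hA hs.2)
    rw [mem_Icc]
    lia
end

section
/- Let n, ℓ, u be nonnegative integers with n ≥ 4(ℓ+u), and fix L ⊆ {0,...,ℓ−1} and U ⊆ {n−u,...,n−1}. Then the number of subsets R ⊆ {ℓ,...,n−u−1} such that, with A = L∪R∪U, the set A−A contains every integer in {−(n−ℓ−u),...,n−ℓ−u}, is greater than (1 − 4·(1/2)^{|L|+|U|} − (n/2)·(3/4)^{(n−ℓ−u)/3})·2^{n−ℓ−u}. -/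
open Finset Pointwise

/-- Counting the subsets of `X` that avoid `F` and contain no pair `{i, i + d}` with `i ∈ S`, when
these pairs are disjoint from each other and from `F`. -/
theorem card_avoiding_pairs_le (d : ℤ) (S : Finset ℤ) (F X : Finset ℤ)
    (hS : ∀ i ∈ S, i ∈ X ∧ i + d ∈ X ∧ i ∉ F ∧ i + d ∉ F ∧ i + d ∉ S) (hF : F ⊆ X) :
    4 ^ S.card * 2 ^ F.card *
      (X.powerset.filter (fun R => Disjoint R F ∧ ∀ i ∈ S, i ∈ R → i + d ∉ R)).card
      ≤ 3 ^ S.card * 2 ^ X.card := by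
  induction S using Finset.induction_on generalizing X with
  | empty =>
    have hsub : (X.powerset.filter
        (fun R => Disjoint R F ∧ ∀ i ∈ (∅ : Finset ℤ), i ∈ R → i + d ∉ R))
        ⊆ (X \ F).powerset := by
      intro R hR
      simp only [mem_filter, mem_powerset] at hR ⊢
      exact subset_sdiff.2 ⟨hR.1, hR.2.1⟩
    have hcard := card_le_card hsub
    rw [card_powerset, card_sdiff_of_subset hF] at hcard
    calc _ ≤ 4 ^ 0 * 2 ^ F.card * 2 ^ (X.card - F.card) := by
            rw [card_empty]; gcongr
      _ = _ := by
        rw [pow_zero, one_mul, ← pow_add, Nat.add_sub_cancel' (card_le_card hF)]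
        simp
  | insert i S hi ih =>
    obtain ⟨h1, h2, h3, h4, h5⟩ := hS i (mem_insert_self i S)
    have hne : i + d ≠ i := fun hh => h5 (by rw [hh]; exact mem_insert_self i S)
    have hpair : ({i, i + d} : Finset ℤ) ⊆ X := by
      intro x hx
      simp only [mem_insert, mem_singleton] at hx
      rcases hx with rfl | rfl <;> assumption
    have hX : (X \ {i, i + d}).card + 2 = X.card := by
      have := card_sdiff_add_card_eq_card hpair
      rwa [card_pair hne.symm] at this
    have hrec := ih (X \ {i, i + d}) (by
      intro j hj
      obtain ⟨g1, g2, g3, g4, g5⟩ := hS j (mem_insert_of_mem hj)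
      have hji : j ≠ i := fun hh => hi (hh ▸ hj)
      have hjid : j ≠ i + d := fun hh => h5 (hh ▸ mem_insert_of_mem hj)
      have hjdi : j + d ≠ i := fun hh => g5 (by rw [hh]; exact mem_insert_self i S)
      refine ⟨?_, ?_, g3, g4, fun hh => g5 (mem_insert_of_mem hh)⟩
      · simp [g1, hji, hjid]
      · simp [g2, hji, hjdi]) (by
      intro x hx
      have hxi : x ≠ i := fun hh => h3 (hh ▸ hx)
      have hxid : x ≠ i + d := fun hh => h4 (hh ▸ hx)
      simp [hF hx, hxi, hxid])
    set T := (X \ {i, i + d}).powerset.filter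
      (fun R => Disjoint R F ∧ ∀ i ∈ S, i ∈ R → i + d ∉ R) with hT
    have hsub : (X.powerset.filter
        (fun R => Disjoint R F ∧ ∀ j ∈ insert i S, j ∈ R → j + d ∉ R))
        ⊆ (T ∪ T.image (insert i)) ∪ T.image (insert (i + d)) := by
      intro R hR
      simp only [mem_filter, mem_powerset] at hR
      obtain ⟨hRX, hRF, hRS⟩ := hR
      have hmem : R \ {i, i + d} ∈ T := by
        simp only [hT, mem_filter, mem_powerset]
        refine ⟨sdiff_subset_sdiff hRX le_rfl, hRF.mono_left sdiff_subset, ?_⟩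
        intro j hj hjR hjR'
        exact hRS j (mem_insert_of_mem hj) (mem_sdiff.1 hjR).1 (mem_sdiff.1 hjR').1
      have hi' := hRS i (mem_insert_self i S)
      simp only [mem_union, mem_image]
      by_cases hiR : i ∈ R
      · have hidR := hi' hiR
        refine Or.inl (Or.inr ⟨_, hmem, ?_⟩)
        ext x
        simp only [mem_insert, mem_sdiff, mem_singleton]
        grind
      · by_cases hidR : i + d ∈ R
        · refine Or.inr ⟨_, hmem, ?_⟩
          ext x
          simp only [mem_insert, mem_sdiff, mem_singleton]
          grind
        · refine Or.inl (Or.inl ?_)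
          convert hmem using 1
          ext x
          simp only [mem_insert, mem_sdiff, mem_singleton]
          grind
    have hcard : (X.powerset.filter
        (fun R => Disjoint R F ∧ ∀ j ∈ insert i S, j ∈ R → j + d ∉ R)).card ≤ 3 * T.card := by
      have e1 := card_le_card hsub
      have e2 := card_union_le (T ∪ T.image (insert i)) (T.image (insert (i + d)))
      have e3 := card_union_le T (T.image (insert i))
      have e4 : (T.image (insert i)).card ≤ T.card := card_image_le
      have e5 : (T.image (insert (i + d))).card ≤ T.card := card_image_le
      omega
    rw [card_insert_of_notMem hi, ← hX]
    calc _ ≤ 4 ^ (S.card + 1) * 2 ^ F.card * (3 * T.card) := by gcongr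
      _ = 12 * (4 ^ S.card * 2 ^ F.card * T.card) := by ring
      _ ≤ 12 * (3 ^ S.card * 2 ^ (X \ {i, i + d}).card) := by gcongr
      _ = _ := by ring

/-- The path-like graph joining `i` to `i + d` on an interval of length `m` has a matching with at
least `m / 3` edges, provided `3 * d ≤ 2 * m`. -/
theorem exists_matching_of_difference (a : ℤ) (m d : ℕ) (hd : 1 ≤ d) (hdm : 3 * d ≤ 2 * m) :
    ∃ S : Finset ℤ, m ≤ 3 * S.card ∧ ∀ i ∈ S, i ∈ Icc a (a + m - 1) ∧
      i + d ∈ Icc a (a + m - 1) ∧ i + d ∉ S := by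
  set N : Finset ℕ := (range (m - d)).filter (fun t => t / d % 2 = 0) with hN
  have hcover : ∃ c : ℕ, range m ⊆ (N ∪ N.image (· + d)) ∪ N.image (· + c) := by
    have hdiv : ∀ t, t / d = 0 → t < d := fun t ht => by
      rcases Nat.div_eq_zero_iff.1 ht with h | h <;> omega
    have hsub : ∀ t, d ≤ t → (t - d) / d = t / d - 1 := fun t ht => by
      have := Nat.sub_mul_div t d 1
      simpa using this
    have hlt : ∀ t, t < d → t / d = 0 := fun t ht => Nat.div_eq_of_lt ht
    by_cases h2 : 2 * d ≤ m
    · refine ⟨2 * d, fun t ht => ?_⟩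
      simp only [mem_union, mem_image, hN, mem_filter, mem_range] at ht ⊢
      rcases Nat.mod_two_eq_zero_or_one (t / d) with hpar | hpar
      · by_cases htd : t + d < m
        · exact Or.inl (Or.inl ⟨by omega, hpar⟩)
        · have ht2 : d ≤ t := by omega
          have hpos : t / d ≠ 0 := fun hh => by have := hdiv t hh; omega
          have e1 := hsub t ht2
          have ht3 : d ≤ t - d := by
            by_contra hcon
            rw [hlt (t - d) (by omega)] at e1
            generalize t / d = q at hpar hpos e1
            omega
          have e2 := hsub (t - d) ht3
          have hquot : (t - d - d) / d % 2 = 0 := by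
            rw [e2, e1]
            generalize t / d = q at hpar hpos
            omega
          exact Or.inr ⟨t - d - d, ⟨by omega, hquot⟩, by omega⟩
      · have ht2 : d ≤ t := by
          by_contra hcon
          have := hlt t (by omega)
          omega
        have e1 := hsub t ht2
        exact Or.inl (Or.inr ⟨t - d, ⟨by omega, by omega⟩, by omega⟩)
    · refine ⟨m - d, fun t ht => ?_⟩
      simp only [mem_union, mem_image, hN, mem_filter, mem_range] at ht ⊢
      by_cases h1 : t < m - d
      · exact Or.inl (Or.inl ⟨h1, by rw [hlt t (by omega)]⟩)
      · by_cases h3 : t < d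
        · exact Or.inr ⟨t - (m - d), ⟨by omega, by rw [hlt _ (by omega)]⟩, by omega⟩
        · exact Or.inl (Or.inr ⟨t - d, ⟨by omega, by rw [hlt _ (by omega)]⟩, by omega⟩)
  obtain ⟨c, hc⟩ := hcover
  refine ⟨N.image (fun t : ℕ => a + (t : ℤ)), ?_, ?_⟩
  · rw [card_image_of_injective _ (fun x y hxy => by simpa using hxy)]
    have e1 := card_le_card hc
    have e2 := card_union_le (N ∪ N.image (· + d)) (N.image (· + c))
    have e3 := card_union_le N (N.image (· + d))
    have e4 : (N.image (· + d)).card ≤ N.card := card_image_le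
    have e5 : (N.image (· + c)).card ≤ N.card := card_image_le
    rw [card_range] at e1
    omega
  · intro i hi
    obtain ⟨t, ht, rfl⟩ := mem_image.1 hi
    simp only [hN, mem_filter, mem_range] at ht
    refine ⟨mem_Icc.2 (by omega), mem_Icc.2 (by omega), fun hh => ?_⟩
    obtain ⟨s, hs, hst⟩ := mem_image.1 hh
    simp only [hN, mem_filter, mem_range] at hs
    have hst' : s = t + d := by
      have : a + (s : ℤ) = a + t + d := hst
      omega
    rw [hst', Nat.add_div_right t (by omega)] at hs
    omega

/-- The number of subsets of an interval of length `m` that, together with any fixed sets, miss a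
difference `d ≤ 2 * m / 3`. -/
theorem card_missing_small_difference_le (a : ℤ) (m d : ℕ) (hd : 1 ≤ d) (hdm : 3 * d ≤ 2 * m)
    (L U : Finset ℤ) :
    (((Icc a (a + m - 1)).powerset.filter
      (fun R => (d : ℤ) ∉ (L ∪ R ∪ U) - (L ∪ R ∪ U))).card : ℝ)
      ≤ (3 / 4 : ℝ) ^ ((m : ℝ) / 3) * 2 ^ m := by
  obtain ⟨S, hcard, hS⟩ := exists_matching_of_difference a m d hd hdm
  have hcount := card_avoiding_pairs_le d S ∅ (Icc a (a + m - 1))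
    (fun i hi => ⟨(hS i hi).1, (hS i hi).2.1, by simp, by simp, (hS i hi).2.2⟩) (by simp)
  have hsub : (Icc a (a + m - 1)).powerset.filter
      (fun R => (d : ℤ) ∉ (L ∪ R ∪ U) - (L ∪ R ∪ U)) ⊆
      (Icc a (a + m - 1)).powerset.filter
        (fun R => Disjoint R ∅ ∧ ∀ i ∈ S, i ∈ R → i + (d : ℤ) ∉ R) := by
    intro R hR
    simp only [mem_filter] at hR ⊢
    refine ⟨hR.1, disjoint_empty_right _, fun i _ hi hid => hR.2 ?_⟩
    exact mem_sub.2 ⟨i + d, by simp [hid], i, by simp [hi], by ring⟩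
  have hX : (Icc a (a + m - 1)).card = m := by
    rw [Int.card_Icc]; omega
  rw [hX, card_empty, pow_zero, mul_one] at hcount
  have hreal : (4 : ℝ) ^ S.card * (((Icc a (a + m - 1)).powerset.filter
      (fun R => (d : ℤ) ∉ (L ∪ R ∪ U) - (L ∪ R ∪ U))).card : ℝ) ≤ 3 ^ S.card * 2 ^ m := by
    exact_mod_cast (Nat.mul_le_mul_left _ (card_le_card hsub)).trans hcount
  have hpow : (3 / 4 : ℝ) ^ S.card ≤ (3 / 4 : ℝ) ^ ((m : ℝ) / 3) := by
    rw [← Real.rpow_natCast]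
    apply Real.rpow_le_rpow_of_exponent_ge (by norm_num) (by norm_num)
    have : (m : ℝ) ≤ 3 * S.card := by exact_mod_cast hcard
    linarith
  refine le_trans ?_ (mul_le_mul_of_nonneg_right hpow (by positivity))
  rw [div_pow, div_mul_eq_mul_div, le_div_iff₀ (by positivity)]
  linarith

/-- The number of subsets of the middle interval that miss a difference `d = m - j`, with
`2 * d` at least the total length. -/
theorem card_missing_large_difference_le (ℓ u m j : ℕ) (hj : j ≤ m)
    (hd : m + ℓ + u ≤ 2 * (m - j)) (hℓ : ℓ ≤ m - j) (hu : u ≤ m - j) (L U : Finset ℤ)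
    (hL : L ⊆ Icc (0 : ℤ) (ℓ - 1)) (hU : U ⊆ Icc ((ℓ : ℤ) + m) (ℓ + m + u - 1)) :
    (((Icc (ℓ : ℤ) (ℓ + m - 1)).powerset.filter
      (fun R => ((m - j : ℕ) : ℤ) ∉ (L ∪ R ∪ U) - (L ∪ R ∪ U))).card : ℝ)
      ≤ (1 / 2 : ℝ) ^ (L.card + U.card) * (3 / 4) ^ j * 2 ^ m := by
  obtain ⟨d, hdj⟩ : ∃ d, d = m - j := ⟨_, rfl⟩
  rw [← hdj] at hd hℓ hu ⊢
  have hL' : ∀ x ∈ L, 0 ≤ x ∧ x ≤ ℓ - 1 := fun x hx => mem_Icc.1 (hL hx)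
  have hU' : ∀ x ∈ U, (ℓ : ℤ) + m ≤ x ∧ x ≤ ℓ + m + u - 1 := fun x hx => mem_Icc.1 (hU hx)
  set F : Finset ℤ := L.image (· + (d : ℤ)) ∪ U.image (· - (d : ℤ)) with hF
  have hFcard : F.card = L.card + U.card := by
    rw [hF, card_union_of_disjoint, card_image_of_injective _ (add_left_injective _),
      card_image_of_injective _ (sub_left_injective)]
    rw [disjoint_left]
    intro x hx hx'
    obtain ⟨y, hy, rfl⟩ := mem_image.1 hx
    obtain ⟨z, hz, hzy⟩ := mem_image.1 hx'
    have := hL' y hy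
    have := hU' z hz
    omega
  have hFmem : ∀ x ∈ F, ((d : ℤ) ≤ x ∧ x ≤ ℓ - 1 + d) ∨
      ((ℓ : ℤ) + m - d ≤ x ∧ x ≤ ℓ + m + u - 1 - d) := by
    intro x hx
    rcases mem_union.1 hx with hx | hx
    · obtain ⟨y, hy, rfl⟩ := mem_image.1 hx
      have := hL' y hy
      left; constructor <;> linarith
    · obtain ⟨y, hy, rfl⟩ := mem_image.1 hx
      have := hU' y hy
      right; constructor <;> linarith
  have hScard : (Icc (ℓ : ℤ) (ℓ + j - 1)).card = j := by
    rw [Int.card_Icc]; omega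
  have hX : (Icc (ℓ : ℤ) (ℓ + m - 1)).card = m := by
    rw [Int.card_Icc]; omega
  have hcount := card_avoiding_pairs_le d (Icc (ℓ : ℤ) (ℓ + j - 1)) F (Icc (ℓ : ℤ) (ℓ + m - 1))
    (by
      intro i hi
      rw [mem_Icc] at hi
      refine ⟨mem_Icc.2 (by omega), mem_Icc.2 (by omega), fun hh => ?_, fun hh => ?_, fun hh => ?_⟩
      · have := hFmem _ hh
        omega
      · have := hFmem _ hh
        omega
      · rw [mem_Icc] at hh
        omega)
    (by
      intro x hx
      have := hFmem x hx
      exact mem_Icc.2 (by omega))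
  have hsub : (Icc (ℓ : ℤ) (ℓ + m - 1)).powerset.filter
      (fun R => (d : ℤ) ∉ (L ∪ R ∪ U) - (L ∪ R ∪ U)) ⊆
      (Icc (ℓ : ℤ) (ℓ + m - 1)).powerset.filter
        (fun R => Disjoint R F ∧ ∀ i ∈ Icc (ℓ : ℤ) (ℓ + j - 1), i ∈ R → i + (d : ℤ) ∉ R) := by
    intro R hR
    simp only [mem_filter] at hR ⊢
    refine ⟨hR.1, ?_, fun i _ hi hid => hR.2 ?_⟩
    · rw [disjoint_left]
      intro x hxR hxF
      apply hR.2
      rcases mem_union.1 hxF with hx | hx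
      · obtain ⟨y, hy, rfl⟩ := mem_image.1 hx
        exact mem_sub.2 ⟨y + d, by simp [hxR], y, by simp [hy], by ring⟩
      · obtain ⟨y, hy, rfl⟩ := mem_image.1 hx
        exact mem_sub.2 ⟨y, by simp [hy], y - d, by simp [hxR], by ring⟩
    · exact mem_sub.2 ⟨i + d, by simp [hid], i, by simp [hi], by ring⟩
  rw [hX, hScard, hFcard] at hcount
  have hreal : (4 : ℝ) ^ j * 2 ^ (L.card + U.card) * (((Icc (ℓ : ℤ) (ℓ + m - 1)).powerset.filter
      (fun R => (d : ℤ) ∉ (L ∪ R ∪ U) - (L ∪ R ∪ U))).card : ℝ) ≤ 3 ^ j * 2 ^ m := by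
    exact_mod_cast (Nat.mul_le_mul_left _ (card_le_card hsub)).trans hcount
  rw [div_pow, div_pow, one_pow, div_mul_div_comm, div_mul_eq_mul_div,
    le_div_iff₀ (by positivity)]
  linarith

/-- If `A - A` contains `1, …, m` with `m` positive, it contains `-m, …, m`. -/
theorem Icc_neg_subset_sub_self {A : Finset ℤ} {m : ℕ} (hm : 0 < m)
    (hA : ∀ j < m, ((m - j : ℕ) : ℤ) ∈ A - A) : Icc (-(m : ℤ)) m ⊆ A - A := by
  have hpos : ∀ x : ℤ, 0 < x → x ≤ m → x ∈ A - A := fun x h0 hxm => by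
    have := hA (m - x.toNat) (by omega)
    rwa [show ((m - (m - x.toNat) : ℕ) : ℤ) = x by omega] at this
  intro x hx
  rw [mem_Icc] at hx
  rcases lt_trichotomy x 0 with h | rfl | h
  · obtain ⟨p, hp, q, hq, hpq⟩ := mem_sub.1 (hpos (-x) (by omega) (by omega))
    exact mem_sub.2 ⟨q, hq, p, hp, by omega⟩
  · obtain ⟨p, hp, -⟩ := mem_sub.1 (hpos m (by omega) le_rfl)
    exact mem_sub.2 ⟨p, hp, p, hp, sub_self p⟩
  · exact hpos x h hx.2

theorem prop_differences (n ℓ u : ℕ) (h : 4 * (ℓ + u) ≤ n) (L U : Finset ℤ)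
    (hL : L ⊆ Finset.Icc (0 : ℤ) ((ℓ : ℤ) - 1))
    (hU : U ⊆ Finset.Icc ((n : ℤ) - u) ((n : ℤ) - 1)) :
    (((Finset.Icc ((ℓ : ℤ)) ((n : ℤ) - u - 1)).powerset.filter
        (fun R : Finset ℤ =>
          Finset.Icc (-((n : ℤ) - ℓ - u)) ((n : ℤ) - ℓ - u)
            ⊆ (L ∪ R ∪ U) - (L ∪ R ∪ U))).card : ℝ)
      > (1 - 4 * (1 / 2 : ℝ) ^ (L.card + U.card)
          - ((n : ℝ) / 2) * (3 / 4 : ℝ) ^ (((n : ℝ) - ℓ - u) / 3)) * 2 ^ (n - ℓ - u) := by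
  obtain ⟨m, hm⟩ : ∃ m, n = m + ℓ + u := ⟨n - ℓ - u, by omega⟩
  have hnat : n - ℓ - u = m := by omega
  have hint : (n : ℤ) - ℓ - u = m := by omega
  have hreal : (n : ℝ) - ℓ - u = m := by rw [hm]; push_cast; ring
  have hend : (n : ℤ) - u - 1 = ℓ + m - 1 := by omega
  rw [hnat, hint, hreal, hend]
  rw [show (n : ℤ) - u = ℓ + m by omega, show (n : ℤ) - 1 = ℓ + m + u - 1 by omega] at hU
  rcases Nat.eq_zero_or_pos m with rfl | hmpos
  · obtain ⟨rfl, rfl⟩ : ℓ = 0 ∧ u = 0 := by omega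
    obtain rfl : n = 0 := by omega
    have hL0 : L = ∅ := by simpa using hL
    have hU0 : U = ∅ := by simpa using hU
    subst hL0 hU0
    refine lt_of_lt_of_le ?_ (Nat.cast_nonneg _)
    norm_num
  set X := Icc (ℓ : ℤ) (ℓ + m - 1) with hX
  have hXcard : X.card = m := by rw [hX, Int.card_Icc]; omega
  set B : ℕ → Finset (Finset ℤ) := fun j => X.powerset.filter
    (fun R => ((m - j : ℕ) : ℤ) ∉ (L ∪ R ∪ U) - (L ∪ R ∪ U)) with hB
  set G := X.powerset.filter
    (fun R : Finset ℤ => Icc (-(m : ℤ)) m ⊆ (L ∪ R ∪ U) - (L ∪ R ∪ U)) with hG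
  set α : ℝ := (3 / 4 : ℝ) ^ ((m : ℝ) / 3) with hα
  set β : ℝ := (1 / 2 : ℝ) ^ (L.card + U.card) with hβ
  have hα0 : 0 ≤ α := by positivity
  have hβ0 : 0 < β := by positivity
  have hcover : X.powerset ⊆ G ∪ (range m).biUnion B := by
    intro R hR
    by_cases hRB : R ∈ (range m).biUnion B
    · exact mem_union_right _ hRB
    · refine mem_union_left _ (mem_filter.2 ⟨hR, Icc_neg_subset_sub_self hmpos fun j hj => ?_⟩)
      by_contra hcon
      exact hRB (mem_biUnion.2 ⟨j, mem_range.2 hj, mem_filter.2 ⟨hR, hcon⟩⟩)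
  have htotal : (2 : ℝ) ^ m ≤ G.card + ∑ j ∈ range m, ((B j).card : ℝ) := by
    have e1 := (card_le_card hcover).trans
      ((card_union_le _ _).trans (Nat.add_le_add_left card_biUnion_le _))
    rw [card_powerset, hXcard] at e1
    exact_mod_cast e1
  have hterm : ∀ j ∈ range m, ((B j).card : ℝ) ≤
      (if 2 * (m - j) < n then α * 2 ^ m else 0) + β * 2 ^ m * (3 / 4) ^ j := by
    intro j hj
    rw [mem_range] at hj
    split_ifs with hsmall
    · have := card_missing_small_difference_le (ℓ : ℤ) m (m - j) (by omega) (by omega) L U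
      have hnn : (0 : ℝ) ≤ β * 2 ^ m * (3 / 4) ^ j := by positivity
      exact this.trans (le_add_of_nonneg_right hnn)
    · have := card_missing_large_difference_le ℓ u m j hj.le (by omega) (by omega) (by omega)
        L U hL hU
      refine this.trans (le_of_eq ?_)
      ring
  have hsum := sum_le_sum hterm
  rw [sum_add_distrib, ← sum_filter, sum_const, nsmul_eq_mul, ← mul_sum] at hsum
  have hfew : (((range m).filter (fun j => 2 * (m - j) < n)).card : ℝ) ≤ n / 2 := by
    have hsub : (range m).filter (fun j => 2 * (m - j) < n) ⊆ Ico (m - n / 2) m := by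
      intro j hj
      rw [mem_filter, mem_range] at hj
      exact mem_Ico.2 (by omega)
    have e1 := card_le_card hsub
    rw [Nat.card_Ico] at e1
    rw [le_div_iff₀ (by norm_num)]
    exact_mod_cast (show _ * 2 ≤ n by omega)
  have hgeom : ∑ j ∈ range m, (3 / 4 : ℝ) ^ j < 4 := by
    rw [geom_sum_eq (by norm_num), div_lt_iff_of_neg (by norm_num)]
    have : (0 : ℝ) < (3 / 4) ^ m := by positivity
    linarith
  have hA : (((range m).filter (fun j => 2 * (m - j) < n)).card : ℝ) * (α * 2 ^ m)
      ≤ n / 2 * (α * 2 ^ m) := mul_le_mul_of_nonneg_right hfew (by positivity)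
  have hC : β * 2 ^ m * ∑ j ∈ range m, (3 / 4 : ℝ) ^ j < β * 2 ^ m * 4 :=
    mul_lt_mul_of_pos_left hgeom (by positivity)
  rw [gt_iff_lt]
  linarith
end

section
/- Let x be a negative integer and n an integer with n ≥ |x|+2, and set S = {0, 1, ..., n−1} ∪ {n+|x|}. Then S+S = {0, 1, ..., 2n+|x|−1} ∪ {2n+2|x|}, S−S = {−(n+|x|), ..., n+|x|}, and consequently |S+S| − |S−S| = x. -/
open Finset Pointwise

/-- The sumset of an interval with one extra point beyond a gap of length `m`. -/
theorem Icc_union_singleton_add_self {m n : ℤ} (hm : 0 ≤ m) (hn : m + 1 ≤ n) :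
    (Icc 0 (n - 1) ∪ {n + m}) + (Icc 0 (n - 1) ∪ {n + m})
      = Icc 0 (2 * n + m - 1) ∪ {2 * n + 2 * m} := by
  ext k
  simp only [mem_add, mem_union, mem_Icc, mem_singleton]
  constructor
  · rintro ⟨a, ha, b, hb, rfl⟩
    omega
  · rintro (hk | rfl)
    · by_cases h₁ : k ≤ n - 1
      · exact ⟨0, by omega, k, by omega, by omega⟩
      by_cases h₂ : k ≤ 2 * n - 2
      · exact ⟨n - 1, by omega, k - (n - 1), by omega, by omega⟩
      · exact ⟨n + m, by omega, k - (n + m), by omega, by omega⟩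
    · exact ⟨n + m, by omega, n + m, by omega, by omega⟩

/-- The difference set of an interval with one extra point beyond a gap of length `m`. -/
theorem Icc_union_singleton_sub_self {m n : ℤ} (hm : 0 ≤ m) (hn : m + 1 ≤ n) :
    (Icc 0 (n - 1) ∪ {n + m}) - (Icc 0 (n - 1) ∪ {n + m}) = Icc (-(n + m)) (n + m) := by
  ext k
  simp only [mem_sub, mem_union, mem_Icc, mem_singleton]
  constructor
  · rintro ⟨a, ha, b, hb, rfl⟩
    omega
  · intro hk
    by_cases h₁ : k < -(n - 1)
    · exact ⟨k + (n + m), by omega, n + m, by omega, by omega⟩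
    by_cases h₂ : k < 0
    · exact ⟨0, by omega, -k, by omega, by omega⟩
    by_cases h₃ : k ≤ n - 1
    · exact ⟨k, by omega, 0, by omega, by omega⟩
    · exact ⟨n + m, by omega, n + m - k, by omega, by omega⟩

theorem negative_imbalance_construction (x : ℤ) (hx : x < 0) (n : ℤ) (hn : |x| + 2 ≤ n) :
    (Finset.Icc 0 (n - 1) ∪ {n + |x|}) + (Finset.Icc 0 (n - 1) ∪ {n + |x|})
        = Finset.Icc 0 (2 * n + |x| - 1) ∪ {2 * n + 2 * |x|} ∧
    (Finset.Icc 0 (n - 1) ∪ {n + |x|}) - (Finset.Icc 0 (n - 1) ∪ {n + |x|})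
        = Finset.Icc (-(n + |x|)) (n + |x|) ∧
    ((((Finset.Icc 0 (n - 1) ∪ {n + |x|}) + (Finset.Icc 0 (n - 1) ∪ {n + |x|})).card : ℤ)
        - (((Finset.Icc 0 (n - 1) ∪ {n + |x|}) - (Finset.Icc 0 (n - 1) ∪ {n + |x|})).card : ℤ))
        = x := by
  have hm : 0 < |x| := abs_pos.mpr hx.ne
  have hadd := Icc_union_singleton_add_self hm.le (show |x| + 1 ≤ n by omega)
  have hsub := Icc_union_singleton_sub_self hm.le (show |x| + 1 ≤ n by omega)
  refine ⟨hadd, hsub, ?_⟩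
  have hx' : |x| = -x := abs_of_neg hx
  have hdisj : Disjoint (Icc 0 (2 * n + |x| - 1)) {2 * n + 2 * |x|} := by
    rw [disjoint_singleton_right, mem_Icc]
    omega
  rw [hadd, hsub, card_union_of_disjoint hdisj, Int.card_Icc, Int.card_Icc, card_singleton]
  omega
end
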